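/- Let n and k be integers with n ≥ 3 and 0 < k ≤ n/2. The accordion graph A[n,k] is NOT a circulant graph (i.e., not isomorphic to any Cayley graph of the cyclic group Z_{2n}) if and only if both n and k are even and k ≥ 4. -/

import Mathlib

open SimpleGraph

/-- The accordion graph `A[n,k]`: vertices `u_i = (false, i)` and `v_i = (true, i)`
for `i : ZMod n`, with edges `u_i u_{i+1}`, `v_i v_{i+1}`, `u_i v_i`, `u_i v_{i+k}`. -/
def accordion (n k : ℕ) : SimpleGraph (Bool × ZMod n) :=
  SimpleGraph.fromRel (fun x y =>
    (x.1 = y.1 ∧ y.2 = x.2 + 1) ∨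
    (x.1 = false ∧ y.1 = true ∧ (y.2 = x.2 ∨ y.2 = x.2 + (k : ZMod n))))

/-- A graph on `2n` vertices is circulant if it is isomorphic to a circulant graph on
the cyclic group `ZMod (2n)`. -/
def IsCirculant {V : Type} (m : ℕ) (G : SimpleGraph V) : Prop :=
  ∃ s : Set (ZMod m), Nonempty (G ≃g SimpleGraph.circulantGraph s)

theorem accordion_adj_same {n : ℕ} [Fact (1 < n)] (k : ℕ) (b : Bool) (i j : ZMod n) :
    (accordion n k).Adj (b, i) (b, j) ↔ j = i + 1 ∨ i = j + 1 := by
  cases b <;> simp [accordion] <;> grind [one_ne_zero (α := ZMod n)]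

theorem accordion_adj_false_true {n : ℕ} (k : ℕ) (i j : ZMod n) :
    (accordion n k).Adj (false, i) (true, j) ↔ j = i ∨ j = i + k := by
  simp [accordion]

theorem accordion_adj_true_false {n : ℕ} (k : ℕ) (i j : ZMod n) :
    (accordion n k).Adj (true, i) (false, j) ↔ i = j ∨ i = j + k := by
  simp [accordion]

/-- Reduction modulo two on `ZMod (2 * n)`. -/
def parity (n : ℕ) : ZMod (2 * n) →+* ZMod 2 :=
  ZMod.castHom (dvd_mul_right 2 n) (ZMod 2)

theorem parity_eq_zero_of_mul_eq_zero {n : ℕ} (hn : 0 < n) {c : ZMod (2 * n)}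
    (h : (n : ZMod (2 * n)) * c = 0) : parity n c = 0 := by
  have : NeZero (2 * n) := ⟨by omega⟩
  obtain ⟨m, rfl⟩ := ZMod.natCast_zmod_surjective c
  rw [← Nat.cast_mul, ZMod.natCast_eq_zero_iff, mul_comm 2 n] at h
  rw [map_natCast, ZMod.natCast_eq_zero_iff]
  exact Nat.dvd_of_mul_dvd_mul_left hn h

theorem two_mul_ne_zero_of_parity {n : ℕ} (hn : Even n) (hn0 : 0 < n) {c : ZMod (2 * n)}
    (h : parity n c ≠ 0) {m : ℕ} (hm : Even m) {e : ZMod (2 * n)} (he : parity n e = 0) :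
    2 * c + m * e ≠ 0 := by
  have : NeZero (2 * n) := ⟨by omega⟩
  obtain ⟨a, rfl⟩ := ZMod.natCast_zmod_surjective c
  obtain ⟨b, rfl⟩ := ZMod.natCast_zmod_surjective e
  intro h0
  rw [map_natCast, ZMod.natCast_eq_zero_iff] at he
  rw [map_natCast, Ne, ZMod.natCast_eq_zero_iff] at h
  have h1 : ((2 * a + m * b : ℕ) : ZMod (2 * n)) = 0 := by exact_mod_cast h0
  rw [ZMod.natCast_eq_zero_iff] at h1
  obtain ⟨n', rfl⟩ := hn
  obtain ⟨m', rfl⟩ := hm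
  obtain ⟨b', rfl⟩ := he
  obtain ⟨q, hq⟩ := h1
  apply h
  have : a + 2 * (m' * b') = 2 * (n' * q) := by linarith
  omega

theorem eq_add_natCast_mul {n : ℕ} {R : Type*} [CommRing R] {f : ZMod n → R}
    (h : ∀ i, f (i + 1) - f i = f i - f (i - 1)) (m : ℕ) :
    f m = f 0 + m * (f 1 - f 0) ∧ f (m + 1) = f 0 + (m + 1) * (f 1 - f 0) := by
  induction m with
  | zero => simp
  | succ m ih =>
    have h1 := h (m + 1)
    rw [add_sub_cancel_right] at h1
    push_cast
    exact ⟨ih.2, by linear_combination h1 + 2 * ih.2 - ih.1⟩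

theorem circulantGraph_adj_sub_comm {G : Type*} [AddCommGroup G] (s : Set G) (a b c d : G)
    (h : a - b = c - d) :
    (circulantGraph s).Adj a b ↔ (circulantGraph s).Adj c d := by
  rw [circulantGraph_adj, circulantGraph_adj, h, ← neg_sub a b, ← neg_sub c d, h,
    ← sub_eq_zero, ← sub_eq_zero (a := c), h]

/-- Two neighbours of a vertex with no other common neighbour are opposite in a
circulant graph. -/
theorem circulantGraph_sub_eq_sub {G : Type*} [AddCommGroup G] {s : Set G} {a b c : G}
    (hab : (circulantGraph s).Adj a b) (hac : (circulantGraph s).Adj a c)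
    (h : ∀ d, (circulantGraph s).Adj d b → (circulantGraph s).Adj d c → d = a) :
    b - a = a - c := by
  have h1 := h (b + c - a)
    ((circulantGraph_adj_sub_comm s _ _ c a (by abel)).2 hac.symm)
    ((circulantGraph_adj_sub_comm s _ _ b a (by abel)).2 hab.symm)
  rw [sub_eq_sub_iff_add_eq_add, ← sub_eq_iff_eq_add, h1]

theorem accordion_eq_of_adj_of_adj {n k : ℕ} [Fact (1 < n)] (h4 : (4 : ZMod n) ≠ 0)
    (hk2 : (k : ZMod n) - 2 ≠ 0) (hk2' : (k : ZMod n) + 2 ≠ 0) (b : Bool) (i : ZMod n)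
    (x : Bool × ZMod n) (h1 : (accordion n k).Adj x (b, i + 1))
    (h2 : (accordion n k).Adj x (b, i - 1)) : x = (b, i) := by
  have h2' : (2 : ZMod n) ≠ 0 := fun h => h4 (by linear_combination 2 * h)
  obtain ⟨c, j⟩ := x
  cases b <;> cases c <;>
    simp only [accordion_adj_same, accordion_adj_false_true, accordion_adj_true_false,
      Prod.mk.injEq, reduceCtorEq, true_and, false_and] at h1 h2 ⊢ <;>
    rcases h1 with h1 | h1 <;> rcases h2 with h2 | h2 <;>
    first
    | linear_combination h2
    | exact absurd (by linear_combination h1 - h2) h2'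
    | exact absurd (by linear_combination h2 - h1) h2'
    | exact absurd (by linear_combination -h1 - h2) h4
    | exact absurd (by linear_combination h1 - h2) hk2
    | exact absurd (by linear_combination h2 - h1) hk2
    | exact absurd (by linear_combination h1 - h2) hk2'
    | exact absurd (by linear_combination h2 - h1) hk2'

theorem not_isCirculant_accordion {n k : ℕ} (hn : Even n) (hk : Even k) (hk4 : 4 ≤ k)
    (hkn : 2 * k ≤ n) : ¬ IsCirculant (2 * n) (accordion n k) := by
  rintro ⟨s, ⟨φ⟩⟩
  have : Fact (1 < n) := ⟨by omega⟩
  have hne (m : ℕ) (h0 : 0 < m) (hm : m < n) : (m : ZMod n) ≠ 0 := by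
    rw [Ne, ZMod.natCast_eq_zero_iff]
    exact Nat.not_dvd_of_pos_of_lt h0 hm
  have h4 : (4 : ZMod n) ≠ 0 := by exact_mod_cast hne 4 (by omega) (by omega)
  have hk2 : (k : ZMod n) - 2 ≠ 0 := by
    have := hne (k - 2) (by omega) (by omega)
    rwa [Nat.cast_sub (by omega)] at this
  have hk2' : (k : ZMod n) + 2 ≠ 0 := by exact_mod_cast hne (k + 2) (by omega) (by omega)
  have step (b : Bool) (i : ZMod n) : φ (b, i + 1) - φ (b, i) = φ (b, i) - φ (b, i - 1) := by
    apply circulantGraph_sub_eq_sub (s := s)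
    · rw [φ.map_adj_iff, accordion_adj_same]; simp
    · rw [φ.map_adj_iff, accordion_adj_same]; simp
    · intro d h1 h2
      obtain ⟨x, rfl⟩ := φ.surjective d
      rw [φ.map_adj_iff] at h1 h2
      rw [accordion_eq_of_adj_of_adj h4 hk2 hk2' b i x h1 h2]
  have prog (b : Bool) (m : ℕ) :
      φ (b, m) = φ (b, 0) + m * (φ (b, 1) - φ (b, 0)) :=
    (eq_add_natCast_mul (f := fun i => φ (b, i)) (step b) m).1
  have even (b : Bool) : parity n (φ (b, 1) - φ (b, 0)) = 0 := by
    apply parity_eq_zero_of_mul_eq_zero (by omega)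
    have := prog b n
    rw [ZMod.natCast_self] at this
    simpa using this.symm
  have par (b : Bool) (i : ZMod n) : parity n (φ (b, i)) = parity n (φ (b, 0)) := by
    have : NeZero n := ⟨by omega⟩
    obtain ⟨m, rfl⟩ := ZMod.natCast_zmod_surjective i
    rw [prog, map_add, map_mul, even, mul_zero, add_zero]
  have odd : parity n (φ (true, 0) - φ (false, 0)) ≠ 0 := by
    intro h
    rw [map_sub, sub_eq_zero] at h
    obtain ⟨⟨b, i⟩, hx⟩ := φ.surjective (φ (false, 0) + 1)
    have h1 := par b i
    rw [hx, map_add, map_one] at h1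
    cases b <;> simp [h] at h1
  have nbr (d : ZMod (2 * n)) (h : (circulantGraph s).Adj (φ (false, 0)) d) :
      d = φ (false, 1) ∨ d = φ (false, -1) ∨ d = φ (true, 0) ∨ d = φ (true, k) := by
    obtain ⟨⟨b, i⟩, rfl⟩ := φ.surjective d
    rw [φ.map_adj_iff] at h
    simp only [φ.injective.eq_iff, Prod.mk.injEq]
    cases b
    · rw [accordion_adj_same] at h
      grind
    · rw [accordion_adj_false_true] at h
      grind
  have hneg : φ (false, -1) = φ (false, 0) - (φ (false, 1) - φ (false, 0)) := by
    have := step false 0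
    simp only [zero_add, zero_sub] at this
    rw [this]; ring
  have hmul (m : ℕ) (h0 : 0 < m) (hm : m < n) :
      (m : ZMod (2 * n)) * (φ (false, 1) - φ (false, 0)) ≠ 0 := by
    intro h
    have h1 := prog false m
    rw [h, add_zero, φ.injective.eq_iff, Prod.mk.injEq] at h1
    exact hne m h0 hm h1.2
  have hK := prog true k
  have adj0 : (accordion n k).Adj (false, 0) (true, 0) := by
    rw [accordion_adj_false_true]; simp
  have adj1 : (accordion n k).Adj (false, 1) (true, 1) := by
    rw [accordion_adj_false_true]; simp
  have adjt : (accordion n k).Adj (true, 0) (true, 1) := by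
    rw [accordion_adj_same]; simp
  rw [← φ.map_adj_iff] at adj0 adj1 adjt
  have ef := even false
  have et := even true
  generalize hc : φ (false, 1) - φ (false, 0) = c at *
  generalize hd : φ (true, 1) - φ (true, 0) = d at *
  generalize hσ : φ (true, 0) - φ (false, 0) = σ at *
  have hf1 : φ (false, 1) = φ (false, 0) + c := by rw [← hc]; ring
  have ht0 : φ (true, 0) = φ (false, 0) + σ := by rw [← hσ]; ring
  have ht1 : φ (true, 1) = φ (false, 0) + σ + d := by rw [← hσ, ← hd]; ring
  rw [hf1, hneg, hK, ht0] at nbr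
  have hcd : d = c ∨ d = -c := by
    have h1 := nbr (φ (false, 0) + d)
      ((circulantGraph_adj_sub_comm s _ _ _ _ (by rw [← hd]; ring)).1 adjt)
    rcases h1 with h | h | h | h
    · left; linear_combination h
    · right; linear_combination h
    · have : d = σ := by linear_combination h
      exact absurd (this ▸ et) odd
    · have : d = σ + k * d := by linear_combination h
      have := congrArg (parity n) this
      simp only [map_add, map_mul, et, mul_zero, add_zero] at this
      exact absurd this.symm odd
  rcases hcd with rfl | rfl
  · have h1 := nbr (φ (false, 0) - σ)
      ((circulantGraph_adj_sub_comm s _ _ _ _ (by rw [← hσ]; ring)).1 adj0.symm)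
    have key {m : ℕ} (hm : Even m) := two_mul_ne_zero_of_parity hn (by omega) odd hm ef
    rcases h1 with h | h | h | h
    · have : σ = -d := by linear_combination -h
      exact odd (by rw [this, map_neg, ef, neg_zero])
    · have : σ = d := by linear_combination -h
      exact odd (by rw [this, ef])
    · exact key (m := 0) (by simp) (by push_cast; linear_combination -h)
    · exact key hk (by linear_combination -h)
  · have h1 := nbr (φ (false, 0) + (σ - 2 * c))
      ((circulantGraph_adj_sub_comm s _ _ _ _ (by rw [hf1, ht1]; ring)).1 adj1)
    rcases h1 with h | h | h | h
    · have : σ = 3 * c := by linear_combination h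
      exact odd (by rw [this, map_mul, ef, mul_zero])
    · have : σ = c := by linear_combination h
      exact odd (by rw [this, ef])
    · exact hmul 2 (by omega) (by omega) (by push_cast; linear_combination -h)
    · refine hmul (k - 2) (by omega) (by omega) ?_
      rw [Nat.cast_sub (by omega)]
      push_cast
      linear_combination h

theorem isCirculant_of_injective {V : Type} [Fintype V] {m : ℕ} [NeZero m] {G : SimpleGraph V}
    (hV : Fintype.card V = m) (s : Set (ZMod m)) (f : V → ZMod m) (hf : f.Injective)
    (h : ∀ x y, (circulantGraph s).Adj (f x) (f y) ↔ G.Adj x y) : IsCirculant m G :=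
  ⟨s, ⟨⟨Equiv.ofBijective f
    ((Fintype.bijective_iff_injective_and_card f).2 ⟨hf, by rw [hV, ZMod.card]⟩), h _ _⟩⟩⟩

theorem isCirculant_accordion_of_odd {n k : ℕ} (hn : 3 ≤ n) (h : Odd n ∨ Odd k) :
    IsCirculant (2 * n) (accordion n k) := by
  have : Fact (1 < n) := ⟨by omega⟩
  have : NeZero n := ⟨by omega⟩
  have : NeZero (2 * n) := ⟨by omega⟩
  obtain ⟨σ, hσ, hσk⟩ : ∃ σ : ZMod (2 * n), parity n σ ≠ 0 ∧ 2 * σ = -(2 * k) := by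
    by_cases hk : Odd k
    · refine ⟨-k, ?_, by ring⟩
      rw [map_neg, map_natCast, neg_ne_zero, (ZMod.natCast_eq_one_iff_odd).2 hk]
      exact one_ne_zero
    · refine ⟨n - k, ?_, ?_⟩
      · rw [map_sub, map_natCast, map_natCast, ZMod.natCast_eq_one_iff_odd.2 (by tauto),
          ZMod.natCast_eq_zero_iff_even.2 (by simpa using hk), sub_zero]
        exact one_ne_zero
      · have : ((2 * n : ℕ) : ZMod (2 * n)) = 0 := ZMod.natCast_self _
        push_cast at this
        linear_combination this
  obtain ⟨D, hD⟩ : ∃ D : ZMod n →+ ZMod (2 * n), ∀ m : ℕ, D m = 2 * m := by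
    have h2n : zmultiplesHom (ZMod (2 * n)) 2 n = 0 := by
      have : ((2 * n : ℕ) : ZMod (2 * n)) = 0 := ZMod.natCast_self _
      push_cast at this
      simpa [mul_comm] using this
    refine ⟨ZMod.lift n ⟨zmultiplesHom _ 2, h2n⟩, fun m => ?_⟩
    have := ZMod.lift_coe n ⟨zmultiplesHom (ZMod (2 * n)) 2, h2n⟩ (m : ℤ)
    rw [Int.cast_natCast] at this
    rw [this]
    simp [mul_comm]
  have hp2 : parity n 2 = 0 := by rw [map_ofNat]; rfl
  have hDp (i : ZMod n) : parity n (D i) = 0 := by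
    obtain ⟨m, rfl⟩ := ZMod.natCast_zmod_surjective i
    rw [hD, map_mul, hp2, zero_mul]
  have hDinj : Function.Injective D := by
    rw [injective_iff_map_eq_zero]
    intro i hi
    obtain ⟨m, rfl⟩ := ZMod.natCast_zmod_surjective i
    rw [hD] at hi
    have hi : ((2 * m : ℕ) : ZMod (2 * n)) = 0 := by exact_mod_cast hi
    rw [ZMod.natCast_eq_zero_iff] at hi ⊢
    exact Nat.dvd_of_mul_dvd_mul_left two_pos hi
  have hDσ (i : ZMod n) : D i ≠ σ := fun h => hσ (h ▸ hDp i)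
  have hD1 : D 1 = 2 := by simpa using hD 1
  let f : Bool × ZMod n → ZMod (2 * n) := fun x => D x.2 + if x.1 then σ else 0
  have hf : f.Injective := by
    rintro ⟨b, i⟩ ⟨c, j⟩ h
    cases b <;> cases c <;> simp [f] at h
    · rw [hDinj h]
    · exact absurd (by rw [map_sub, h]; ring) (hDσ (i - j))
    · exact absurd (by rw [map_sub, ← h]; ring) (hDσ (j - i))
    · rw [hDinj h]
  refine isCirculant_of_injective (by simp [ZMod.card]) {2, σ} f hf ?_
  have e1 (i j : ZMod n) : D i - D j = 2 ↔ i = j + 1 := by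
    rw [← hDinj.eq_iff, map_add, hD1, sub_eq_iff_eq_add']
  have e2 (i j : ZMod n) : D i - D j ≠ σ := by
    rw [← map_sub]; exact hDσ _
  have e3 (i j : ZMod n) : D i + σ - D j ≠ 2 := by
    intro h
    exact hDσ (1 + j - i) (by rw [map_sub, map_add, hD1]; linear_combination -h)
  have e4 (i j : ZMod n) : D i - (D j + σ) ≠ 2 := by
    intro h
    exact hDσ (i - j - 1) (by rw [map_sub, map_sub, hD1]; linear_combination h)
  have e5 (i j : ZMod n) : D i + σ - D j = σ ↔ i = j := by
    rw [← hDinj.eq_iff]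
    constructor <;> intro h <;> linear_combination h
  have e6 (i j : ZMod n) : D i - (D j + σ) = σ ↔ j = i + k := by
    rw [← hDinj.eq_iff, map_add, hD]
    constructor <;> intro h <;> linear_combination -h - hσk
  have hirr (x y) : (circulantGraph {2, σ}).Adj (f x) (f y) ↔
      x ≠ y ∧ (f x - f y ∈ ({2, σ} : Set _) ∨ f y - f x ∈ ({2, σ} : Set _)) := by
    rw [circulantGraph_adj, hf.eq_iff]
  rintro ⟨b, i⟩ ⟨c, j⟩
  have h1 : (1 : ZMod n) ≠ 0 := one_ne_zero
  rw [hirr]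
  cases b <;> cases c <;>
    simp only [accordion_adj_same, accordion_adj_false_true, accordion_adj_true_false, f,
      Set.mem_insert_iff, Set.mem_singleton_iff, if_true, if_false, add_zero, e1, e2, e3, e4,
      e5, e6, add_sub_add_right_eq_sub, Bool.false_eq_true] <;>
    grind

theorem isCirculant_accordion_two {n : ℕ} (hn : 3 ≤ n) :
    IsCirculant (2 * n) (accordion n 2) := by
  have : Fact (1 < n) := ⟨by omega⟩
  have : NeZero n := ⟨by omega⟩
  have : NeZero (2 * n) := ⟨by omega⟩
  let π : ZMod (2 * n) →+* ZMod n := ZMod.castHom (dvd_mul_left n 2) (ZMod n)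
  let g : Bool × ZMod n → ZMod n := fun x => x.2 - if x.1 then 1 else 0
  let f : Bool × ZMod n → ZMod (2 * n) :=
    fun x => (((g x).val + if x.1 then n else 0 : ℕ) : ZMod (2 * n))
  have hπ (x) : π (f x) = g x := by
    obtain ⟨b, i⟩ := x
    cases b <;> simp only [f, map_natCast] <;> simp
  have hf : f.Injective := by
    rintro ⟨b, i⟩ ⟨c, j⟩ h
    have hg : g (b, i) = g (c, j) := by rw [← hπ, ← hπ, h]
    have hlt := (g (c, j)).val_lt
    have h' := congrArg ZMod.val h
    simp only [f, hg] at h'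
    rw [ZMod.val_natCast_of_lt (by split_ifs <;> omega),
      ZMod.val_natCast_of_lt (by split_ifs <;> omega)] at h'
    have hbc : b = c := by
      cases b <;> cases c <;> simp at h' ⊢ <;> omega
    subst hbc
    simpa [g] using hg
  refine isCirculant_of_injective (by simp [ZMod.card]) {z | π z = 1} f hf ?_
  rintro ⟨b, i⟩ ⟨c, j⟩
  have h1 : (1 : ZMod n) ≠ 0 := one_ne_zero
  rw [circulantGraph_adj, hf.eq_iff]
  simp only [Set.mem_ofPred_eq, map_sub, hπ]
  cases b <;> cases c <;>
    simp only [accordion_adj_same, accordion_adj_false_true, accordion_adj_true_false, g,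
      if_true, if_false, Bool.false_eq_true, Nat.cast_ofNat] <;>
    grind

/-- For `n ≥ 3` and `0 < k ≤ n/2`, the accordion graph `A[n,k]` is not circulant iff
both `n` and `k` are even with `k ≥ 4`. -/
theorem accordion_not_isCirculant_iff (n k : ℕ) (hn : 3 ≤ n) (hk : 0 < k)
    (hkn : 2 * k ≤ n) :
    ¬ IsCirculant (2 * n) (accordion n k) ↔ Even n ∧ Even k ∧ 4 ≤ k := by
  refine ⟨fun h => ?_, fun ⟨h1, h2, h3⟩ => not_isCirculant_accordion h1 h2 h3 hkn⟩
  have hodd : ¬ (Odd n ∨ Odd k) := fun ho => h (isCirculant_accordion_of_odd hn ho)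
  rw [not_or, Nat.not_odd_iff_even, Nat.not_odd_iff_even] at hodd
  refine ⟨hodd.1, hodd.2, ?_⟩
  by_contra hk4
  obtain ⟨m, hm⟩ := hodd.2
  obtain rfl : k = 2 := by omega
  exact h (isCirculant_accordion_two hn)
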